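/- arXiv:1404.2624 — 2 statements merged into one kernel-verified Lean document; each statement's English description precedes it below -/
import Mathlib

section
/- Let V be a finite set of points in the Euclidean plane ℝ² with |V| even and |V| ≥ 4, and suppose that N(V) = 3|V|/2. Then there exist a point c ∈ ℝ² and a real r > 0 such that ‖v − c‖ = r for every v ∈ V (V lies on a circle with centre c), and V is symmetric with respect to c, i.e. 2c − v ∈ V for every v ∈ V. -/
open scoped RealInnerProductSpace Classical

noncomputable section

abbrev Euc (d : ℕ) : Type := EuclideanSpace ℝ (Fin d)

/-- `{p, q}` is a double-normal pair of the finite point set `V`. -/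
def IsDNPair {d : ℕ} (V : Finset (Euc d)) (p q : Euc d) : Prop :=
  p ∈ V ∧ q ∈ V ∧ p ≠ q ∧
    ∀ v ∈ V, 0 ≤ ⟪v - p, q - p⟫ ∧ 0 ≤ ⟪v - q, p - q⟫

/-- `N(V)`: the number of (unordered) double-normal pairs of `V`. -/
def numDN {d : ℕ} (V : Finset (Euc d)) : ℕ :=
  ((V ×ˢ V).filter fun pq => IsDNPair V pq.1 pq.2).card / 2

/-- `{p, q}` is a strict double-normal pair of `V`. -/
def IsStrictDNPair {d : ℕ} (V : Finset (Euc d)) (p q : Euc d) : Prop :=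
  IsDNPair V p q ∧
    ∀ v ∈ V, v ≠ p → v ≠ q → 0 < ⟪v - p, q - p⟫ ∧ 0 < ⟪v - q, p - q⟫

/-- `N'(V)`: the number of (unordered) strict double-normal pairs of `V`. -/
def numStrictDN {d : ℕ} (V : Finset (Euc d)) : ℕ :=
  ((V ×ˢ V).filter fun pq => IsStrictDNPair V pq.1 pq.2).card / 2

theorem dn_co {V : Finset (Euc 2)} {p q v : Euc 2} (h : IsDNPair V p q) (hv : v ∈ V) :
    0 ≤ (v 0 - p 0) * (q 0 - p 0) + (v 1 - p 1) * (q 1 - p 1) ∧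
    0 ≤ (v 0 - q 0) * (p 0 - q 0) + (v 1 - q 1) * (p 1 - q 1) := by
  have := h.2.2.2 v hv
  simp only [EuclideanSpace.inner_eq_star_dotProduct, dotProduct,
    Fin.sum_univ_two, PiLp.sub_apply, star_trivial, Pi.star_apply] at this
  constructor
  · linarith [this.1]
  · linarith [this.2]

theorem dn_symm {V : Finset (Euc 2)} {p q : Euc 2} (h : IsDNPair V p q) : IsDNPair V q p :=
  ⟨h.2.1, h.1, h.2.2.1.symm, fun v hv => ⟨(h.2.2.2 v hv).2, (h.2.2.2 v hv).1⟩⟩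

theorem euc_ext {x y : Euc 2} (h0 : x 0 = y 0) (h1 : x 1 = y 1) : x = y := by
  ext i; fin_cases i
  · exact h0
  · exact h1

theorem euc_ne {x y : Euc 2} (h : x ≠ y) : 0 < (x 0 - y 0) ^ 2 + (x 1 - y 1) ^ 2 := by
  by_contra hc
  apply h
  apply euc_ext <;> nlinarith [sq_nonneg (x 0 - y 0), sq_nonneg (x 1 - y 1)]

/-- oriented cross product of `x - p` and `y - p` -/
def cr (σ : ℝ) (p x y : Euc 2) : ℝ :=
  σ * ((x 0 - p 0) * (y 1 - p 1) - (x 1 - p 1) * (y 0 - p 0))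

theorem same_dir {V : Finset (Euc 2)} {p x y : Euc 2} {σ : ℝ} (hσ : σ ^ 2 = 1)
    (hx : IsDNPair V p x) (hy : IsDNPair V p y)
    (h : cr σ p x y = 0) : x = y := by
  have hσ0 : σ ≠ 0 := by rintro rfl; norm_num at hσ
  have h' := (mul_eq_zero.1 h).resolve_left hσ0
  have h1 := dn_co hx hy.2.1
  have h2 := dn_co hy hx.2.1
  have h3 := euc_ne hx.2.2.1
  have h4 := euc_ne hy.2.2.1
  obtain ⟨a, ha⟩ : ∃ a, a = x 0 - p 0 := ⟨_, rfl⟩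
  obtain ⟨b, hb⟩ : ∃ b, b = x 1 - p 1 := ⟨_, rfl⟩
  obtain ⟨c, hc⟩ : ∃ c, c = y 0 - p 0 := ⟨_, rfl⟩
  obtain ⟨d, hd⟩ : ∃ d, d = y 1 - p 1 := ⟨_, rfl⟩
  have e1 : x 0 = p 0 + a := by linarith
  have e2 : x 1 = p 1 + b := by linarith
  have e3 : y 0 = p 0 + c := by linarith
  have e4 : y 1 = p 1 + d := by linarith
  rw [e1, e2, e3, e4] at h1 h2 h'
  rw [e1, e2] at h3
  rw [e3, e4] at h4
  have k1 : 0 ≤ a * c + b * d := by linarith [h1.1]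
  have k2 : a * c + b * d ≤ a * a + b * b := by linarith [h1.2]
  have k3 : a * c + b * d ≤ c * c + d * d := by linarith [h2.2]
  have k4 : 0 < a * a + b * b := by linarith
  have k5 : 0 < c * c + d * d := by linarith
  have k6 : a * d - b * c = 0 := by linarith
  have k7 : (a * c + b * d) ^ 2 = (a * a + b * b) * (c * c + d * d) := by
    linear_combination (-(a * d - b * c)) * k6
  have k8 : 0 < a * c + b * d := by
    rcases k1.lt_or_eq with h | h
    · exact h
    · rw [← h] at k7; nlinarith [mul_pos k4 k5]
  clear h1 h2 h3 h4 h' h hx hy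
  have k9 : a * a + b * b ≤ a * c + b * d := by nlinarith
  have k10 : c * c + d * d ≤ a * c + b * d := by nlinarith
  have k11 : a - c = 0 := by
    apply pow_eq_zero_iff (two_ne_zero) |>.1
    apply le_antisymm _ (sq_nonneg _)
    linarith [sq_nonneg (b - d)]
  have k12 : b - d = 0 := by
    apply pow_eq_zero_iff (two_ne_zero) |>.1
    apply le_antisymm _ (sq_nonneg _)
    linarith [sq_nonneg (a - c)]
  apply euc_ext <;> linarith

theorem rect_real {D x y z w : ℝ} (hD : 0 < D) (hy : 0 < y) (hw : 0 < w)
    (_hx0 : 0 ≤ x) (_hx1 : x ≤ D) (hz0 : 0 ≤ z) (hz1 : z ≤ D)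
    (h1 : y * w ≤ x * z) (h2 : y * w ≤ (D - x) * (D - z))
    (h3 : x * (D - x) ≤ y ^ 2) (h4 : z * (D - z) ≤ w ^ 2) :
    z = D - x ∧ w = y ∧ y ^ 2 = x * (D - x) := by
  have hyw := mul_pos hy hw
  have hxz : 0 < x * z := by linarith
  have hxz' : 0 < (D - x) * (D - z) := by linarith
  have a1 : x * (D - x) * (z * (D - z)) ≤ y ^ 2 * w ^ 2 :=
    mul_le_mul h3 h4 (mul_nonneg hz0 (by linarith)) (by positivity)
  have b1 : x * z = y * w := by
    by_contra hne
    have : y * w < x * z := lt_of_le_of_ne h1 (Ne.symm hne)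
    nlinarith [mul_pos (sub_pos.2 this) hxz', mul_nonneg hyw.le (sub_nonneg.2 h2)]
  have b2 : (D - x) * (D - z) = y * w := by
    by_contra hne
    have : y * w < (D - x) * (D - z) := lt_of_le_of_ne h2 (Ne.symm hne)
    nlinarith [mul_pos (sub_pos.2 this) hyw]
  have b3 : z = D - x := by
    have : D * (D - x - z) = 0 := by linarith
    rcases mul_eq_zero.1 this with h | h <;> linarith
  subst b3
  have c1 : y ≤ w := by
    have : y * (w - y) ≥ 0 → y ≤ w := fun h => by
      by_contra hc; push Not at hc; nlinarith [mul_pos hy (sub_pos.2 hc)]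
    by_contra hc
    push Not at hc
    nlinarith [mul_pos hw (sub_pos.2 hc)]
  have c2 : w ≤ y := by
    by_contra hc
    push Not at hc
    nlinarith [mul_pos hy (sub_pos.2 hc)]
  have c3 : w = y := le_antisymm c2 c1
  subst c3
  refine ⟨rfl, rfl, by nlinarith⟩

def Un (V : Finset (Euc 2)) (σ : ℝ) (p q : Euc 2) : Prop :=
  IsDNPair V p q ∧ ∃ r s, IsDNPair V p r ∧ IsDNPair V q s ∧ 0 < cr σ p r q ∧ 0 < cr σ q s p

theorem un_symm {V : Finset (Euc 2)} {σ : ℝ} {p q : Euc 2} (h : Un V σ p q) : Un V σ q p := by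
  obtain ⟨h, r, s, h1, h2, h3, h4⟩ := h
  exact ⟨dn_symm h, s, r, h2, h1, h4, h3⟩

/-- parametrised rectangle -/
theorem un_rect {V : Finset (Euc 2)} {σ : ℝ} (hσ : σ ^ 2 = 1) {p q : Euc 2} (h : Un V σ p q) :
    ∃ (r s : Euc 2) (a b k : ℝ), IsDNPair V p q ∧ IsDNPair V p r ∧ IsDNPair V q s ∧
      0 < cr σ p r q ∧ 0 < k ∧ 0 < a * a + b * b ∧
      r 0 = p 0 + a ∧ r 1 = p 1 + b ∧ s 0 = p 0 - σ * k * b ∧ s 1 = p 1 + σ * k * a ∧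
      q 0 = p 0 + a - σ * k * b ∧ q 1 = p 1 + b + σ * k * a := by
  obtain ⟨h, r, s, h1, h2, h3, h4⟩ := h
  have g1 := dn_co h h1.2.1
  have g2 := dn_co h h2.2.1
  have g3 := dn_co h1 h2.2.1
  have g4 := dn_co h1 h.2.1
  have g5 := dn_co h2 h.1
  have g6 := dn_co h2 h1.2.1
  have hq := euc_ne h.2.2.1
  have hr := euc_ne h1.2.2.1
  unfold cr at h3 h4
  obtain ⟨a, ha⟩ : ∃ a, a = r 0 - p 0 := ⟨_, rfl⟩
  obtain ⟨b, hb⟩ : ∃ b, b = r 1 - p 1 := ⟨_, rfl⟩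
  obtain ⟨c, hc⟩ : ∃ c, c = s 0 - p 0 := ⟨_, rfl⟩
  obtain ⟨d, hd⟩ : ∃ d, d = s 1 - p 1 := ⟨_, rfl⟩
  obtain ⟨e, he⟩ : ∃ e, e = q 0 - p 0 := ⟨_, rfl⟩
  obtain ⟨f, hf⟩ : ∃ f, f = q 1 - p 1 := ⟨_, rfl⟩
  have e1 : r 0 = p 0 + a := by linarith
  have e2 : r 1 = p 1 + b := by linarith
  have e3 : s 0 = p 0 + c := by linarith
  have e4 : s 1 = p 1 + d := by linarith
  have e5 : q 0 = p 0 + e := by linarith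
  have e6 : q 1 = p 1 + f := by linarith
  have hcr : 0 < cr σ p r q := h3
  rw [e1, e2, e5, e6] at h3
  rw [e3, e4, e5, e6] at h4
  rw [e1, e2] at hr
  rw [e5, e6] at hq
  rw [e1, e2, e5, e6] at g1 g4
  rw [e3, e4, e5, e6] at g2 g5
  rw [e1, e2, e3, e4] at g3
  rw [e1, e2, e3, e4, e5, e6] at g6
  have hD : 0 < e * e + f * f := by linarith
  have hA : 0 < a * a + b * b := by linarith
  have hrs : 0 ≤ a * c + b * d := by linarith [g3.1]
  have hrq1 : (a * a + b * b) - (a * e + b * f) ≥ 0 := by linarith [g4.2]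
  have hsq1 : (c * c + d * d) - (c * e + d * f) ≥ 0 := by linarith [g5.2]
  have hqq : (a - e) * (c - e) + (b - f) * (d - f) ≥ 0 := by linarith [g6.1]
  have key := rect_real (D := e * e + f * f) (x := a * e + b * f) (y := σ * (a * f - b * e))
    (z := c * e + d * f) (w := σ * (e * d - f * c)) hD (by linarith) (by linarith)
    (by linarith [g1.1]) (by linarith [g1.2]) (by linarith [g2.1]) (by linarith [g2.2])
    (by
      have := mul_nonneg hD.le hrs
      linear_combination this + (a * f - b * e) * (e * d - f * c) * hσ)
    (by
      have := mul_nonneg hD.le hqq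
      linear_combination this + (a * f - b * e) * (e * d - f * c) * hσ)
    (by
      have := mul_nonneg hD.le hrq1
      linear_combination this - (a * f - b * e) ^ 2 * hσ)
    (by
      have := mul_nonneg hD.le hsq1
      linear_combination this - (e * d - f * c) ^ 2 * hσ)
  obtain ⟨k1, k2, k3⟩ := key
  have hσ0 : σ ≠ 0 := by rintro rfl; norm_num at hσ
  have k2' := mul_left_cancel₀ hσ0 k2
  have hc' : c = e - a := by
    have : (e * e + f * f) * (c - (e - a)) = 0 := by linear_combination e * k1 - f * k2'
    rcases mul_eq_zero.1 this with h | h <;> linarith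
  have hd' : d = f - b := by
    have : (e * e + f * f) * (d - (f - b)) = 0 := by linear_combination f * k1 + e * k2'
    rcases mul_eq_zero.1 this with h | h <;> linarith
  have hperp : a * c + b * d = 0 := by
    have : (e * e + f * f) * (a * c + b * d) = 0 := by
      rw [hc', hd']
      linear_combination -k3 + (a * f - b * e) ^ 2 * hσ
    rcases mul_eq_zero.1 this with h | h <;> linarith
  have hAne := hA.ne'
  have hX : 0 < σ * (a * d - b * c) := by rw [hc', hd']; linarith
  obtain ⟨k, hk⟩ : ∃ k, k = σ * (a * d - b * c) / (a * a + b * b) := ⟨_, rfl⟩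
  have hk0 : 0 < k := hk ▸ div_pos hX hA
  have hk' : k * (a * a + b * b) = σ * (a * d - b * c) := by rw [hk]; exact div_mul_cancel₀ _ hAne
  have hcv : c = - (σ * k * b) := by
    apply mul_left_cancel₀ hAne
    linear_combination a * hperp + σ * b * hk' + (a * d - b * c) * b * hσ
  have hdv : d = σ * k * a := by
    apply mul_left_cancel₀ hAne
    linear_combination b * hperp - σ * a * hk' - (a * d - b * c) * a * hσ
  refine ⟨r, s, a, b, k, h, h1, h2, hcr, hk0, hA, e1, e2, ?_, ?_, ?_, ?_⟩ <;>
    linarith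

structure Rc (V : Finset (Euc 2)) (σ : ℝ) (p q r s : Euc 2) (a b k : ℝ) : Prop where
  pq : IsDNPair V p q
  pr : IsDNPair V p r
  qs : IsDNPair V q s
  cr0 : 0 < cr σ p r q
  k0 : 0 < k
  A0 : 0 < a * a + b * b
  r0 : r 0 = p 0 + a
  r1 : r 1 = p 1 + b
  s0 : s 0 = p 0 - σ * k * b
  s1 : s 1 = p 1 + σ * k * a
  q0 : q 0 = p 0 + a - σ * k * b
  q1 : q 1 = p 1 + b + σ * k * a

theorem un_rc {V : Finset (Euc 2)} {σ : ℝ} (hσ : σ ^ 2 = 1) {p q : Euc 2} (h : Un V σ p q) :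
    ∃ (r s : Euc 2) (a b k : ℝ), Rc V σ p q r s a b k := by
  obtain ⟨r, s, a, b, k, h1, h2, h3, h4, h5, h6, h7, h8, h9, h10, h11, h12⟩ := un_rect hσ h
  exact ⟨r, s, a, b, k, h1, h2, h3, h4, h5, h6, h7, h8, h9, h10, h11, h12⟩

theorem un_unique {V : Finset (Euc 2)} {σ : ℝ} (hσ : σ ^ 2 = 1) {p q q' : Euc 2}
    (h : Un V σ p q) (h' : Un V σ p q') : q = q' := by
  obtain ⟨r, s, a, b, k, R⟩ := un_rc hσ h
  obtain ⟨r', s', a', b', k', R'⟩ := un_rc hσ h'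
  have g1 := (dn_co R'.pr R.qs.2.1).1
  have g2 := (dn_co R.pr R'.qs.2.1).1
  rw [R.s0, R.s1, R'.r0, R'.r1] at g1
  rw [R'.s0, R'.s1, R.r0, R.r1] at g2
  have g1' : 0 ≤ k * (σ * (a * b' - b * a')) := by linarith
  have g2' : 0 ≤ k' * (-(σ * (a * b' - b * a'))) := by linarith
  have i1 := nonneg_of_mul_nonneg_right g1' R.k0
  have i2 := nonneg_of_mul_nonneg_right g2' R'.k0
  have hr : r = r' := by
    apply same_dir hσ R.pr R'.pr
    unfold cr
    rw [R.r0, R.r1, R'.r0, R'.r1]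
    linarith
  subst hr
  have ea : a' = a := by linarith [R.r0, R'.r0]
  have eb : b' = b := by linarith [R.r1, R'.r1]
  subst ea eb
  have g3 := (dn_co R.pq R'.pq.2.1).2
  have g4 := (dn_co R'.pq R.pq.2.1).2
  rw [R.q0, R.q1, R'.q0, R'.q1] at g3 g4
  have l3 : 0 ≤ (a' * a' + b' * b') * (k * (k - k')) := by
    linear_combination g3 + (a' * a' + b' * b') * (k * (k - k')) * hσ
  have l4 : 0 ≤ (a' * a' + b' * b') * (k' * (k' - k)) := by
    linear_combination g4 + (a' * a' + b' * b') * (k' * (k' - k)) * hσ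
  have j3 := nonneg_of_mul_nonneg_right (nonneg_of_mul_nonneg_right l3 R.A0) R.k0
  have j4 := nonneg_of_mul_nonneg_right (nonneg_of_mul_nonneg_right l4 R.A0) R'.k0
  have ek : k = k' := by linarith
  subst ek
  apply euc_ext
  · rw [R.q0, R'.q0]
  · rw [R.q1, R'.q1]

/-- rightmost marked pairs -/
def Mk (V : Finset (Euc 2)) (σ : ℝ) (p q : Euc 2) : Prop :=
  IsDNPair V p q ∧ ∀ r, IsDNPair V p r → cr σ p r q ≤ 0

theorem cr_swap (σ : ℝ) (p x y : Euc 2) : cr σ p x y = - cr σ p y x := by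
  unfold cr; ring

theorem mk_unique {V : Finset (Euc 2)} {σ : ℝ} (hσ : σ ^ 2 = 1) {p q q' : Euc 2}
    (h : Mk V σ p q) (h' : Mk V σ p q') : q = q' := by
  apply same_dir hσ h.1 h'.1
  have h1 := h.2 _ h'.1
  have h2 := h'.2 _ h.1
  rw [cr_swap] at h1
  linarith

theorem tri {V : Finset (Euc 2)} {σ : ℝ} {p q : Euc 2} (h : IsDNPair V p q) :
    Un V σ p q ∨ Mk V σ p q ∨ Mk V σ q p := by
  by_cases h1 : Mk V σ p q
  · exact Or.inr (Or.inl h1)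
  by_cases h2 : Mk V σ q p
  · exact Or.inr (Or.inr h2)
  left
  unfold Mk at h1 h2
  push Not at h1 h2
  obtain ⟨r, hr, hr'⟩ := h1 h
  obtain ⟨s, hs, hs'⟩ := h2 (dn_symm h)
  exact ⟨h, r, s, hr, hs, hr', hs'⟩

theorem card_fst_le (V : Finset (Euc 2)) (P : Euc 2 → Euc 2 → Prop)
    (hu : ∀ p q q', P p q → P p q' → q = q') :
    ((V ×ˢ V).filter fun x => P x.1 x.2).card = 
    (((V ×ˢ V).filter fun x => P x.1 x.2).image Prod.fst).card := by
  symm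
  apply Finset.card_image_of_injOn
  rintro ⟨p, q⟩ hx ⟨p', q'⟩ hy hxy
  simp only [Finset.coe_filter, Finset.mem_product, Set.mem_setOf_eq] at hx hy hxy
  subst hxy
  rw [hu _ _ _ hx.2 hy.2]

theorem img_sub (V : Finset (Euc 2)) (P : Euc 2 → Euc 2 → Prop) :
    ((V ×ˢ V).filter fun x => P x.1 x.2).image Prod.fst ⊆ V := by
  intro x hx
  simp only [Finset.mem_image, Finset.mem_filter, Finset.mem_product] at hx
  obtain ⟨y, hy, rfl⟩ := hx
  exact hy.1.1

theorem all_un {V : Finset (Euc 2)} (hN : 2 * numDN V = 3 * V.card) {σ : ℝ} (hσ : σ ^ 2 = 1) :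
    ∀ p ∈ V, ∃ q, Un V σ p q := by
  have hU := card_fst_le V (Un V σ) (fun p q q' => un_unique hσ)
  have hM := card_fst_le V (Mk V σ) (fun p q q' => mk_unique hσ)
  have hU' := img_sub V (Un V σ)
  have hM' := Finset.card_le_card (img_sub V (Mk V σ))
  have hsub : ((V ×ˢ V).filter fun x => IsDNPair V x.1 x.2) ⊆
      ((V ×ˢ V).filter fun x => Un V σ x.1 x.2) ∪
      (((V ×ˢ V).filter fun x => Mk V σ x.1 x.2) ∪
      ((V ×ˢ V).filter fun x => Mk V σ x.1 x.2).image Prod.swap) := by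
    rintro ⟨p, q⟩ hx
    rw [Finset.mem_filter, Finset.mem_product] at hx
    rw [Finset.mem_union, Finset.mem_union]
    rcases tri (σ := σ) hx.2 with h | h | h
    · left; rw [Finset.mem_filter, Finset.mem_product]; exact ⟨hx.1, h⟩
    · right; left; rw [Finset.mem_filter, Finset.mem_product]; exact ⟨hx.1, h⟩
    · right; right; rw [Finset.mem_image]
      refine ⟨(q, p), ?_, rfl⟩
      rw [Finset.mem_filter, Finset.mem_product]; exact ⟨hx.1.symm, h⟩
  have c1 := Finset.card_le_card hsub
  have c2 := Finset.card_union_le ((V ×ˢ V).filter fun x => Un V σ x.1 x.2)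
      (((V ×ˢ V).filter fun x => Mk V σ x.1 x.2) ∪
      ((V ×ˢ V).filter fun x => Mk V σ x.1 x.2).image Prod.swap)
  have c3 := Finset.card_union_le ((V ×ˢ V).filter fun x => Mk V σ x.1 x.2)
      (((V ×ˢ V).filter fun x => Mk V σ x.1 x.2).image Prod.swap)
  have c4 := Finset.card_image_le (s := (V ×ˢ V).filter fun x => Mk V σ x.1 x.2) (f := Prod.swap)
  unfold numDN at hN
  have heq := Finset.eq_of_subset_of_card_le hU' (by omega)
  intro p hp
  rw [← heq] at hp
  simp only [Finset.mem_image, Finset.mem_filter, Finset.mem_product] at hp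
  obtain ⟨⟨x, y⟩, hy, rfl⟩ := hp
  exact ⟨y, hy.2⟩

theorem no_mk {V : Finset (Euc 2)} {σ : ℝ} (hσ : σ ^ 2 = 1)
    (hall : ∀ p ∈ V, ∃ q, Un V σ p q) {p p' : Euc 2} (h : Un V (-σ) p p') : ¬ Mk V σ p p' := by
  intro hm
  obtain ⟨q, hq⟩ := hall p h.1.1
  obtain ⟨r, s, a, b, k, R⟩ := un_rc hσ hq
  have g1 := hm.2 r R.pr
  have g2 := (dn_co h.1 R.qs.2.1).1
  rw [R.s0, R.s1] at g2
  have g2' : 0 ≤ k * cr σ p r p' := by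
    unfold cr; rw [R.r0, R.r1]; linarith
  have g3 := nonneg_of_mul_nonneg_right g2' R.k0
  have hr : r = p' := same_dir hσ R.pr h.1 (le_antisymm g1 g3)
  subst hr
  obtain ⟨x, y, a', b', k', L⟩ := un_rc (by rw [neg_sq]; exact hσ) h
  have g4 := (dn_co L.pr R.pq.2.1).2
  have hc := L.cr0
  unfold cr at hc
  have ea : a = a' + σ * k' * b' := by linarith [R.r0, L.q0]
  have eb : b = b' - σ * k' * a' := by linarith [R.r1, L.q1]
  rw [L.r0, L.r1, R.r0, R.r1, ea, eb] at hc
  rw [L.r0, L.r1, R.q0, R.q1, ea, eb] at g4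
  have hc' : 0 < k' * (a' * a' + b' * b') := mul_pos L.k0 L.A0
  have : 0 < k * (k' * (a' * a' + b' * b')) := mul_pos R.k0 hc'
  have e : 0 ≤ - (k * (k' * (a' * a' + b' * b'))) := by
    linear_combination g4 - k * (k' * (a' * a' + b' * b')) * hσ
  linarith

theorem un_flip {V : Finset (Euc 2)} {σ : ℝ} (hσ : σ ^ 2 = 1)
    (hall : ∀ p ∈ V, ∃ q, Un V σ p q) {p p' : Euc 2} (h : Un V (-σ) p p') : Un V σ p p' := by
  rcases tri (σ := σ) h.1 with h1 | h1 | h1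
  · exact h1
  · exact absurd h1 (no_mk hσ hall h)
  · exact absurd h1 (no_mk hσ hall (un_symm h))

theorem un_next {V : Finset (Euc 2)} {σ : ℝ} (hσ : σ ^ 2 = 1)
    (hall : ∀ p ∈ V, ∃ q, Un V (-σ) p q) {p q r s : Euc 2} {a b k : ℝ}
    (R : Rc V σ p q r s a b k) : Un V (-σ) r s := by
  obtain ⟨r', hr'⟩ := hall r R.pr.2.1
  obtain ⟨x, y, c, d, l, L⟩ := un_rc (by rw [neg_sq]; exact hσ) hr'
  have g1 := (dn_co (dn_symm R.pr) L.qs.2.1).1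
  have g2 := (dn_co L.pr R.pq.2.1).1
  have g3 := (dn_co hr'.1 R.qs.2.1).2
  have g4 := (dn_co R.pq L.qs.2.1).2
  rw [L.s0, L.s1, R.r0, R.r1] at g1
  rw [L.r0, L.r1, R.r0, R.r1, R.q0, R.q1] at g2
  have g1' : 0 ≤ l * (-(σ * (a * d - b * c))) := by linarith
  have g2' : 0 ≤ k * (σ * (a * d - b * c)) := by linarith
  have i1 := nonneg_of_mul_nonneg_right g1' L.k0
  have i2 := nonneg_of_mul_nonneg_right g2' R.k0
  have hx : x = p := by
    apply same_dir hσ L.pr (dn_symm R.pr)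
    unfold cr
    rw [L.r0, L.r1, R.r0, R.r1]
    linarith
  subst hx
  have ec : c = -a := by linarith [R.r0, L.r0]
  have ed : d = -b := by linarith [R.r1, L.r1]
  subst ec ed
  rw [L.q0, L.q1, R.s0, R.s1, R.r0, R.r1] at g3
  rw [L.s0, L.s1, R.q0, R.q1, R.r0, R.r1] at g4
  have l3 : 0 ≤ (a * a + b * b) * (l * (l - k)) := by
    linear_combination g3 + (a * a + b * b) * (l * (l - k)) * hσ
  have l4 : 0 ≤ (a * a + b * b) * (k * (k - l)) := by
    linear_combination g4 + (a * a + b * b) * (k * (k - l)) * hσ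
  have j3 := nonneg_of_mul_nonneg_right (nonneg_of_mul_nonneg_right l3 R.A0) L.k0
  have j4 := nonneg_of_mul_nonneg_right (nonneg_of_mul_nonneg_right l4 R.A0) R.k0
  have ek : k = l := by linarith
  subst ek
  have : s = r' := by
    apply euc_ext
    · rw [R.s0, L.q0, R.r0]; ring
    · rw [R.s1, L.q1, R.r1]; ring
  rw [this]; exact hr'

theorem cross_pos {V : Finset (Euc 2)} {p q r s r' s' : Euc 2} {a b k a' b' k' : ℝ}
    (R : Rc V 1 p q r s a b k) (L : Rc V (-1) p q r' s' a' b' k') : 0 < a * b' - b * a' := by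
  have e0 : a - k * b = a' + k' * b' := by linarith [R.q0, L.q0]
  have e1 : b + k * a = b' - k' * a' := by linarith [R.q1, L.q1]
  have h : (a * b' - b * a') * ((a - k * b) ^ 2 + (b + k * a) ^ 2)
      = (k + k') * ((a * a + b * b) * (a' * a' + b' * b')) := by
    have t1 : (a * b' - b * a') * ((a - k * b) ^ 2 + (b + k * a) ^ 2)
      = (a * (b + k * a) - b * (a - k * b)) * ((a - k * b) * a' + (b + k * a) * b') +
        (a * (a - k * b) + b * (b + k * a)) * ((a - k * b) * b' - (b + k * a) * a') := by ring
    have t2 : (a - k * b) * a' + (b + k * a) * b' = a' * a' + b' * b' := by rw [e0, e1]; ring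
    have t3 : (a - k * b) * b' - (b + k * a) * a' = k' * (a' * a' + b' * b') := by rw [e0, e1]; ring
    rw [t1, t2, t3]; ring
  have hp : 0 < (k + k') * ((a * a + b * b) * (a' * a' + b' * b')) :=
    mul_pos (add_pos R.k0 L.k0) (mul_pos R.A0 L.A0)
  rw [← h] at hp
  exact pos_of_mul_pos_left hp (by positivity)

theorem cone {V : Finset (Euc 2)} {p q r s r' s' v : Euc 2} {a b k a' b' k' : ℝ}
    (R : Rc V 1 p q r s a b k) (L : Rc V (-1) p q r' s' a' b' k') (hv : v ∈ V) {x y : ℝ}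
    (hs : s 0 * x + s 1 * y ≤ p 0 * x + p 1 * y) (hs' : s' 0 * x + s' 1 * y ≤ p 0 * x + p 1 * y) :
    v 0 * x + v 1 * y ≤ p 0 * x + p 1 * y := by
  have hc := cross_pos R L
  rw [R.s0, R.s1] at hs
  rw [L.s0, L.s1] at hs'
  have g1 := (dn_co R.pr hv).1
  have g2 := (dn_co L.pr hv).1
  rw [R.r0, R.r1] at g1
  rw [L.r0, L.r1] at g2
  have i1 : 0 ≤ b * x - a * y := nonneg_of_mul_nonneg_right (by linarith : 0 ≤ k * (b * x - a * y)) R.k0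
  have i2 : 0 ≤ a' * y - b' * x :=
    nonneg_of_mul_nonneg_right (by linarith : 0 ≤ k' * (a' * y - b' * x)) L.k0
  have m1 := mul_nonneg g2 i1
  have m2 := mul_nonneg g1 i2
  have : 0 ≤ (a * b' - b * a') * (p 0 * x + p 1 * y - (v 0 * x + v 1 * y)) := by
    linear_combination m1 + m2
  linarith [nonneg_of_mul_nonneg_right this hc]

theorem doubleNormal_plane_equality_structure (V : Finset (Euc 2))
    (heven : Even V.card) (hV : 4 ≤ V.card) (hN : 2 * numDN V = 3 * V.card) :
    ∃ (c : Euc 2) (r : ℝ), 0 < r ∧ (∀ v ∈ V, ‖v - c‖ = r) ∧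
      ∀ v ∈ V, (2 : ℝ) • c - v ∈ V := by
  have h1 : ((1 : ℝ)) ^ 2 = 1 := by norm_num
  have h2 : ((-1 : ℝ)) ^ 2 = 1 := by norm_num
  have allR := all_un hN h1
  have allL := all_un hN h2
  have flipLR : ∀ {p q}, Un V (-1) p q → Un V 1 p q := fun h => un_flip h1 allR h
  have flipRL : ∀ {p q}, Un V 1 p q → Un V (-1) p q := fun h =>
    un_flip h2 allL (by rw [neg_neg]; exact h)
  obtain ⟨p₀, hp₀⟩ : V.Nonempty := Finset.card_pos.1 (by omega)
  obtain ⟨q₀, hq₀⟩ := allR p₀ hp₀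
  obtain ⟨Q, hQ⟩ : ∃ Q : Euc 2 → Euc 2 → Prop, ∀ p q, Q p q ↔ (Un V 1 p q ∧
    p 0 + q 0 = p₀ 0 + q₀ 0 ∧ p 1 + q 1 = p₀ 1 + q₀ 1 ∧
    (p 0 - q 0) ^ 2 + (p 1 - q 1) ^ 2 = (p₀ 0 - q₀ 0) ^ 2 + (p₀ 1 - q₀ 1) ^ 2) :=
    ⟨_, fun _ _ => Iff.rfl⟩
  have main : ∀ v ∈ V, ∃ q, Q v q := by
    by_contra hcon
    push Not at hcon
    obtain ⟨v, hv, hvQ⟩ := hcon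
    obtain ⟨w, hw⟩ := allR v hv
    obtain ⟨r, s, a, b, k, R⟩ := un_rc h1 hw
    obtain ⟨r', s', a', b', k', L⟩ := un_rc h2 (flipRL hw)
    have hc := cross_pos R L
    obtain ⟨p, hp, hmax⟩ := Finset.exists_max_image (V.filter fun p => ∃ q, Q p q)
      (fun p => p 0 * (-a - a') + p 1 * (-b - b')) ⟨p₀, by
        rw [Finset.mem_filter]
        exact ⟨hp₀, q₀, (hQ _ _).2 ⟨hq₀, rfl, rfl, rfl⟩⟩⟩
    rw [Finset.mem_filter] at hp
    obtain ⟨hpV, q, hpq⟩ := hp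
    rw [hQ] at hpq
    obtain ⟨hU, t0, t1, t2⟩ := hpq
    obtain ⟨pr, ps, c, d, l, RR⟩ := un_rc h1 hU
    obtain ⟨pr', ps', c', d', l', LL⟩ := un_rc h2 (flipRL hU)
    have m1 := hmax ps (by
      rw [Finset.mem_filter]
      refine ⟨RR.qs.2.1, pr, (hQ _ _).2 ⟨un_symm (flipLR (un_next h1 allL RR)), ?_, ?_, ?_⟩⟩
      · rw [← t0, RR.s0, RR.r0, RR.q0]; ring
      · rw [← t1, RR.s1, RR.r1, RR.q1]; ring
      · rw [← t2, RR.s0, RR.r0, RR.q0, RR.s1, RR.r1, RR.q1]; ring)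
    have m2 := hmax ps' (by
      rw [Finset.mem_filter]
      refine ⟨LL.qs.2.1, pr', (hQ _ _).2 ⟨un_symm ?_, ?_, ?_, ?_⟩⟩
      · have := un_next h2 (by rw [neg_neg]; exact allR) LL
        rwa [neg_neg] at this
      · rw [← t0, LL.s0, LL.r0, LL.q0]; ring
      · rw [← t1, LL.s1, LL.r1, LL.q1]; ring
      · rw [← t2, LL.s0, LL.r0, LL.q0, LL.s1, LL.r1, LL.q1]; ring)
    have hle := cone RR LL hv m1 m2
    have g1 := (dn_co R.pr hpV).1
    have g2 := (dn_co L.pr hpV).1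
    rw [R.r0, R.r1] at g1
    rw [L.r0, L.r1] at g2
    have z1 : (p 0 - v 0) * a + (p 1 - v 1) * b = 0 := by linarith
    have z2 : (p 0 - v 0) * a' + (p 1 - v 1) * b' = 0 := by linarith
    have z3 : (a * b' - b * a') * (p 0 - v 0) = 0 := by linear_combination b' * z1 - b * z2
    have z4 : (a * b' - b * a') * (p 1 - v 1) = 0 := by linear_combination a * z2 - a' * z1
    have z5 := (mul_eq_zero.1 z3).resolve_left hc.ne'
    have z6 := (mul_eq_zero.1 z4).resolve_left hc.ne'
    have : p = v := euc_ext (by linarith) (by linarith)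
    subst this
    exact hvQ q ((hQ _ _).2 ⟨hU, t0, t1, t2⟩)
  refine ⟨(1 / 2 : ℝ) • (p₀ + q₀), (1 / 2) * ‖p₀ - q₀‖, ?_, ?_, ?_⟩
  · have := norm_pos_iff.2 (sub_ne_zero.2 hq₀.1.2.2.1)
    positivity
  · intro v hv
    obtain ⟨q, hq⟩ := main v hv
    rw [hQ] at hq
    obtain ⟨hU, t0, t1, t2⟩ := hq
    have e : v - (1 / 2 : ℝ) • (p₀ + q₀) = (1 / 2 : ℝ) • (v - q) := by
      apply euc_ext
      · simp only [PiLp.sub_apply, PiLp.smul_apply, PiLp.add_apply, smul_eq_mul]; linarith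
      · simp only [PiLp.sub_apply, PiLp.smul_apply, PiLp.add_apply, smul_eq_mul]; linarith
    rw [e, norm_smul, EuclideanSpace.norm_eq, EuclideanSpace.norm_eq]
    simp only [Fin.sum_univ_two, PiLp.sub_apply, Real.norm_eq_abs, sq_abs]
    rw [t2]
    norm_num
  · intro v hv
    obtain ⟨q, hq⟩ := main v hv
    rw [hQ] at hq
    obtain ⟨hU, t0, t1, t2⟩ := hq
    have e : (2 : ℝ) • (1 / 2 : ℝ) • (p₀ + q₀) - v = q := by
      apply euc_ext
      · simp only [PiLp.sub_apply, PiLp.smul_apply, PiLp.add_apply, smul_eq_mul]; linarith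
      · simp only [PiLp.sub_apply, PiLp.smul_apply, PiLp.add_apply, smul_eq_mul]; linarith
    rw [e]
    exact hU.1.2.1
end
end

section
/- Let S² be the unit sphere in ℝ³ centred at the origin and let V ⊆ S² be a finite set with |V| ≥ 4. Then the number of strict double-normal pairs of V (regarded as a subset of ℝ³) is at most 2|V| − 2. -/
open scoped RealInnerProductSpace Classical

noncomputable section

/-- Orientation determinant of four indexed points. -/
def dt {ι : Type} (x y z : ι → ℝ) (a b c d : ι) : ℝ :=
  (x b - x a) * ((y c - y a) * (z d - z a) - (z c - z a) * (y d - y a))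
  - (y b - y a) * ((x c - x a) * (z d - z a) - (z c - z a) * (x d - x a))
  + (z b - z a) * ((x c - x a) * (y d - y a) - (y c - y a) * (x d - x a))

/-- Exposed edges. -/
def Expo {ι : Type} (x y z : ι → ℝ) (a b : ι) : Prop :=
  ∃ u v w : ℝ, u * x a + v * y a + w * z a = u * x b + v * y b + w * z b ∧
    ∀ i, i ≠ a → i ≠ b → u * x i + v * y i + w * z i < u * x a + v * y a + w * z a

/-- Oriented facets. -/
def Fac {ι : Type} (x y z : ι → ℝ) (a b c : ι) : Prop :=
  a ≠ b ∧ b ≠ c ∧ a ≠ c ∧ ∀ i, i ≠ a → i ≠ b → i ≠ c → 0 < dt x y z a b c i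

/-- General position. -/
def Gen {ι : Type} (x y z : ι → ℝ) : Prop :=
  Function.Injective z ∧ ∀ a b c d, a ≠ b → a ≠ c → a ≠ d → b ≠ c → b ≠ d → c ≠ d →
    dt x y z a b c d ≠ 0

lemma Fac.rot {ι : Type} {x y z : ι → ℝ} {a b c : ι} (h : Fac x y z a b c) : Fac x y z b c a := by
  obtain ⟨h1, h2, h3, h4⟩ := h
  refine ⟨h2, h3.symm, h1.symm, fun i hb hc ha => ?_⟩
  have := h4 i ha hb hc
  have e : dt x y z b c a i = dt x y z a b c i := by unfold dt; ring
  rw [e]; exact this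

lemma Expo.fac {ι : Type} [Fintype ι] {x y z : ι → ℝ} {a b : ι} (hg : Gen x y z) (hab : a ≠ b)
    (hN : 3 ≤ Fintype.card ι) (h : Expo x y z a b) : ∃ c, Fac x y z a b c := by
  obtain ⟨u, v, w, h1, h2⟩ := h
  obtain ⟨i0, hi0⟩ : ∃ i, i ∉ ({a, b} : Finset ι) := by
    by_contra hcon
    push Not at hcon
    have h3 : (Finset.univ : Finset ι) ⊆ {a, b} := fun i _ => hcon i
    have := Finset.card_le_card h3
    rw [Finset.card_univ] at this
    have := Finset.card_le_two (a := a) (b := b)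
    omega
  obtain ⟨s1, s2, s3, hs⟩ : ∃ s1 s2 s3 : ℝ, s1 = v * (z b - z a) - w * (y b - y a) ∧
    s2 = w * (x b - x a) - u * (z b - z a) ∧ s3 = u * (y b - y a) - v * (x b - x a) :=
    ⟨_, _, _, rfl, rfl, rfl⟩
  obtain ⟨hs1, hs2, hs3⟩ := hs
  let H : ι → ℝ := fun i => u * (x a - x i) + v * (y a - y i) + w * (z a - z i)
  let g : ι → ℝ := fun i => s1 * (x i - x a) + s2 * (y i - y a) + s3 * (z i - z a)
  obtain ⟨c, hc, hmin⟩ := Finset.exists_min_image (({a, b} : Finset ι)ᶜ) (fun i => g i / H i)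
    ⟨i0, by simpa using hi0⟩
  have Hpos : ∀ i, i ≠ a → i ≠ b → 0 < H i := fun i ha hb => by
    have := h2 i ha hb
    simp only [H]; linarith
  have hc' : c ≠ a ∧ c ≠ b := by simpa using hc
  refine ⟨c, hab, hc'.2.symm, hc'.1.symm, fun i ha hb hic => ?_⟩
  have hm := hmin i (by simp [ha, hb])
  rw [div_le_div_iff₀ (Hpos c hc'.1 hc'.2) (Hpos i ha hb)] at hm
  have key : g i * H c - g c * H i = (u ^ 2 + v ^ 2 + w ^ 2) * dt x y z a b c i := by
    simp only [g, H, dt, hs1, hs2, hs3]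
    linear_combination ((u * ((y c - y a) * (z i - z a) - (z c - z a) * (y i - y a))
  - v * ((x c - x a) * (z i - z a) - (z c - z a) * (x i - x a))
  + w * ((x c - x a) * (y i - y a) - (y c - y a) * (x i - x a)))) * h1
  have hu : 0 < u ^ 2 + v ^ 2 + w ^ 2 := by
    by_contra hcon
    have e1 : u = 0 := by nlinarith [sq_nonneg u, sq_nonneg v, sq_nonneg w]
    have e2 : v = 0 := by nlinarith [sq_nonneg u, sq_nonneg v, sq_nonneg w]
    have e3 : w = 0 := by nlinarith [sq_nonneg u, sq_nonneg v, sq_nonneg w]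
    have := h2 i ha hb
    simp [e1, e2, e3] at this
  have hne := hg.2 a b c i hab hc'.1.symm ha.symm hc'.2.symm hb.symm hic.symm
  have h0 : 0 ≤ (u ^ 2 + v ^ 2 + w ^ 2) * dt x y z a b c i := by linarith
  exact lt_of_le_of_ne (nonneg_of_mul_nonneg_right h0 hu) hne.symm

lemma fac_nonneg {ι : Type} {x y z : ι → ℝ} {a b c : ι} (h : Fac x y z a b c) (i : ι) :
    0 ≤ dt x y z a b c i ∧ (dt x y z a b c i = 0 → i = a ∨ i = b ∨ i = c) := by
  obtain ⟨-, -, -, h4⟩ := h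
  by_cases ha : i = a
  · subst ha; refine ⟨le_of_eq ?_, by simp⟩; unfold dt; ring
  by_cases hb : i = b
  · subst hb; refine ⟨le_of_eq ?_, by simp⟩; unfold dt; ring
  by_cases hc : i = c
  · subst hc; refine ⟨le_of_eq ?_, by simp⟩; unfold dt; ring
  have := h4 i ha hb hc
  exact ⟨this.le, fun h => absurd h this.ne'⟩

lemma mid_aux {A B l m d1 d2 : ℝ} (hA : A = l * d1 + m * d2) (hAB : A + B = 0)
    (hB : 0 ≤ B) (hl : 0 < l) (hm : 0 < m) (h1 : 0 ≤ d1) (h2 : 0 ≤ d2) : d1 = 0 ∧ d2 = 0 := by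
  have p1 := mul_nonneg hl.le h1
  have p2 := mul_nonneg hm.le h2
  have q1 : l * d1 = 0 := by linarith
  have q2 : m * d2 = 0 := by linarith
  exact ⟨(mul_eq_zero.1 q1).resolve_left hl.ne', (mul_eq_zero.1 q2).resolve_left hm.ne'⟩

lemma mid_id {ι : Type} (x y z : ι → ℝ) (a b c a' c' : ι) :
    ((z c' - z b) * dt x y z a b c a' + (z b - z a') * dt x y z a b c c') +
    ((z c - z b) * dt x y z a' b c' a + (z b - z a) * dt x y z a' b c' c) = 0 := by
  unfold dt; ring

lemma mid_up {ι : Type} {x y z : ι → ℝ} {a b c a' c' : ι} (h : Fac x y z a b c)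
    (h' : Fac x y z a' b c') (h1 : z a < z b) (h2 : z b < z c) (h3 : z a' < z b) (h4 : z b < z c') :
    a' = a ∧ c' = c := by
  have e := mid_id x y z a b c a' c'
  have f1 := fac_nonneg h a'
  have f2 := fac_nonneg h c'
  have f3 := fac_nonneg h' a
  have f4 := fac_nonneg h' c
  obtain ⟨g1, g2⟩ := mid_aux rfl e (add_nonneg (mul_nonneg (by linarith) f3.1)
    (mul_nonneg (by linarith) f4.1)) (by linarith) (by linarith) f1.1 f2.1
  constructor
  · rcases f1.2 g1 with r | r | r
    · exact r
    · subst r; linarith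
    · subst r; linarith
  · rcases f2.2 g2 with r | r | r
    · subst r; linarith
    · subst r; linarith
    · exact r

lemma mid_down {ι : Type} {x y z : ι → ℝ} {a b c a' c' : ι} (h : Fac x y z a b c)
    (h' : Fac x y z a' b c') (h1 : z b < z a) (h2 : z c < z b) (h3 : z b < z a') (h4 : z c' < z b) :
    a' = a ∧ c' = c := by
  have e := mid_id x y z a b c a' c'
  have e' : ((z b - z c') * dt x y z a b c a' + (z a' - z b) * dt x y z a b c c') +
    ((z b - z c) * dt x y z a' b c' a + (z a - z b) * dt x y z a' b c' c) = 0 := by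
    linear_combination -e
  have f1 := fac_nonneg h a'
  have f2 := fac_nonneg h c'
  have f3 := fac_nonneg h' a
  have f4 := fac_nonneg h' c
  obtain ⟨g1, g2⟩ := mid_aux rfl e' (add_nonneg (mul_nonneg (by linarith) f3.1)
    (mul_nonneg (by linarith) f4.1)) (by linarith) (by linarith) f1.1 f2.1
  constructor
  · rcases f1.2 g1 with r | r | r
    · exact r
    · subst r; linarith
    · subst r; linarith
  · rcases f2.2 g2 with r | r | r
    · subst r; linarith
    · subst r; linarith
    · exact r

lemma mids_card {ι : Type} [Fintype ι] {z : ι → ℝ}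
    (hN : 3 ≤ Fintype.card ι) (hz : Function.Injective z) (M : Finset (ι × ι × ι))
    (hM : ∀ t ∈ M, ∃ p q, z p < z t.2.1 ∧ z t.2.1 < z q)
    (hinj : Set.InjOn (fun t : ι × ι × ι => t.2.1) M) : M.card ≤ Fintype.card ι - 2 := by
  have hne : (Finset.univ : Finset ι).Nonempty := by
    rw [← Finset.card_pos, Finset.card_univ]; omega
  obtain ⟨p, -, hp⟩ := Finset.exists_min_image Finset.univ z hne
  obtain ⟨q, -, hq⟩ := Finset.exists_max_image Finset.univ z hne
  have hpq : p ≠ q := by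
    rintro rfl
    have : ∀ i j : ι, i = j := fun i j => by
      apply hz
      have := hp i (by simp)
      have := hp j (by simp)
      have := hq i (by simp)
      have := hq j (by simp)
      linarith
    have : Fintype.card ι ≤ 1 := Fintype.card_le_one_iff.2 this
    omega
  have hc : ({p, q} : Finset ι)ᶜ.card = Fintype.card ι - 2 := by
    rw [Finset.card_compl, Finset.card_pair hpq]
  rw [← hc]
  refine Finset.card_le_card_of_injOn (fun t => t.2.1) (fun t ht => ?_) hinj
  obtain ⟨p', q', h1, h2⟩ := hM t ht
  have := hp p' (by simp)
  have := hq q' (by simp)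
  simp only [Finset.coe_compl, Set.mem_compl_iff, Finset.mem_coe, Finset.mem_insert,
    Finset.mem_singleton, not_or]
  constructor
  · rintro h; rw [h] at h1; linarith
  · rintro h; rw [h] at h2; linarith

theorem gen_bound {ι : Type} [Fintype ι] {x y z : ι → ℝ} (hg : Gen x y z)
    (hN : 3 ≤ Fintype.card ι) (col : ι → Bool) (E : Finset (ι × ι))
    (hE : ∀ e ∈ E, col e.1 ≠ col e.2 ∧ Expo x y z e.1 e.2) :
    E.card ≤ 4 * (Fintype.card ι - 2) := by
  let U : Finset (ι × ι × ι) := Finset.univ.filter fun t =>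
    Fac x y z t.1 t.2.1 t.2.2 ∧ z t.1 < z t.2.1 ∧ z t.2.1 < z t.2.2
  let L : Finset (ι × ι × ι) := Finset.univ.filter fun t =>
    Fac x y z t.1 t.2.1 t.2.2 ∧ z t.2.1 < z t.1 ∧ z t.2.2 < z t.2.1
  have hU : U.card ≤ Fintype.card ι - 2 := by
    apply mids_card hN hg.1
    · intro t ht
      simp only [U, Finset.mem_filter] at ht
      exact ⟨_, _, ht.2.2.1, ht.2.2.2⟩
    · rintro ⟨a, b, c⟩ ht ⟨a', b', c'⟩ ht' hb
      simp only at hb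
      subst hb
      simp only [U, Finset.coe_filter, Set.mem_ofPred_eq] at ht ht'
      obtain ⟨r1, r2⟩ := mid_up ht.2.1 ht'.2.1 ht.2.2.1 ht.2.2.2 ht'.2.2.1 ht'.2.2.2
      rw [r1, r2]
  have hL : L.card ≤ Fintype.card ι - 2 := by
    apply mids_card hN hg.1
    · intro t ht
      simp only [L, Finset.mem_filter] at ht
      exact ⟨_, _, ht.2.2.2, ht.2.2.1⟩
    · rintro ⟨a, b, c⟩ ht ⟨a', b', c'⟩ ht' hb
      simp only at hb
      subst hb
      simp only [L, Finset.coe_filter, Set.mem_ofPred_eq] at ht ht'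
      obtain ⟨r1, r2⟩ := mid_down ht.2.1 ht'.2.1 ht.2.2.1 ht.2.2.2 ht'.2.2.1 ht'.2.2.2
      rw [r1, r2]
  have hex : ∀ e : ι × ι, ∃ t : ι × ι × ι, e ∈ E → (t ∈ U ∪ L ∧
      (e = (t.1, t.2.1) ∨ e = (t.2.1, t.2.2) ∨ e = (t.2.2, t.1))) := by
    rintro ⟨a, b⟩
    by_cases he : (a, b) ∈ E
    swap
    · exact ⟨(a, a, a), fun h => absurd h he⟩
    obtain ⟨h1, h2⟩ := hE _ he
    simp only at h1 h2
    have hab : a ≠ b := fun h => h1 (by rw [h])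
    obtain ⟨c, hf⟩ := h2.fac hg hab hN
    have n1 : z a ≠ z b := fun h => hab (hg.1 h)
    have n2 : z b ≠ z c := fun h => hf.2.1 (hg.1 h)
    have n3 : z a ≠ z c := fun h => hf.2.2.1 (hg.1 h)
    have m : (a, b, c) ∈ U ∪ L ∨ (b, c, a) ∈ U ∪ L ∨ (c, a, b) ∈ U ∪ L := by
      simp only [U, L, Finset.mem_union, Finset.mem_filter, Finset.mem_univ, true_and, hf, hf.rot,
        hf.rot.rot]
      rcases lt_or_gt_of_ne n1 with h1 | h1 <;> rcases lt_or_gt_of_ne n2 with h2 | h2 <;>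
      rcases lt_or_gt_of_ne n3 with h3 | h3 <;> simp [h1, h2, h3]
    rcases m with m | m | m
    · exact ⟨_, fun _ => ⟨m, by simp⟩⟩
    · exact ⟨_, fun _ => ⟨m, by simp⟩⟩
    · exact ⟨_, fun _ => ⟨m, by simp⟩⟩
  choose f hf using hex
  have h1 : E.card ≤ 2 * (E.image f).card := by
    apply Finset.card_le_mul_card_image
    rintro ⟨p, q, r⟩ -
    have hsub : ∀ e ∈ E.filter (fun e => f e = (p, q, r)), col e.1 ≠ col e.2 ∧
        (e = (p, q) ∨ e = (q, r) ∨ e = (r, p)) := by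
      intro e he
      simp only [Finset.mem_filter] at he
      have := (hf e he.1).2
      rw [he.2] at this
      exact ⟨(hE e he.1).1, this⟩
    have hcol : col p = col q ∨ col q = col r ∨ col r = col p := by
      cases col p <;> cases col q <;> cases col r <;> simp
    rcases hcol with h | h | h
    · refine le_trans (Finset.card_le_card (t := {(q, r), (r, p)}) fun e he => ?_)
        Finset.card_le_two
      obtain ⟨k1, rfl | rfl | rfl⟩ := hsub e he
      · exact absurd h k1
      · simp
      · simp
    · refine le_trans (Finset.card_le_card (t := {(p, q), (r, p)}) fun e he => ?_)
        Finset.card_le_two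
      obtain ⟨k1, rfl | rfl | rfl⟩ := hsub e he
      · simp
      · exact absurd h k1
      · simp
    · refine le_trans (Finset.card_le_card (t := {(p, q), (q, r)}) fun e he => ?_)
        Finset.card_le_two
      obtain ⟨k1, rfl | rfl | rfl⟩ := hsub e he
      · simp
      · simp
      · exact absurd h k1
  have h2 : (E.image f).card ≤ (U ∪ L).card := by
    apply Finset.card_le_card
    intro t ht
    obtain ⟨e, he, rfl⟩ := Finset.mem_image.1 ht
    exact (hf e he).1
  have h3 := Finset.card_union_le U L
  omega

lemma cubic_ev (c0 c1 c2 c3 : ℝ) (h : c3 ≠ 0) :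
    ∀ᶠ t in nhdsWithin (0 : ℝ) {0}ᶜ, c0 + c1 * t + c2 * t ^ 2 + c3 * t ^ 3 ≠ 0 := by
  apply nhdsNE_le_cofinite
  let P : Polynomial ℝ := Polynomial.C c0 + Polynomial.C c1 * Polynomial.X +
    Polynomial.C c2 * Polynomial.X ^ 2 + Polynomial.C c3 * Polynomial.X ^ 3
  have hP : P ≠ 0 := by
    intro h0
    have := congrArg (fun p => Polynomial.coeff p 3) h0
    simp [P, Polynomial.coeff_X, Polynomial.coeff_C] at this
    exact h this
  change ∀ᶠ t in Filter.cofinite, c0 + c1 * t + c2 * t ^ 2 + c3 * t ^ 3 ≠ 0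
  rw [Filter.eventually_cofinite]
  refine (P.roots.toFinset.finite_toSet).subset fun t ht => ?_
  simp only [ne_eq, not_not, Set.mem_ofPred_eq] at ht
  simp only [Finset.mem_coe, Multiset.mem_toFinset, Polynomial.mem_roots hP, Polynomial.IsRoot.def]
  simpa [P] using ht

/-- A three by three determinant. -/
def d3 (a b c d e f g h i : ℝ) : ℝ :=
  a * (e * i - f * h) - b * (d * i - f * g) + c * (d * h - e * g)

lemma d3_cubic (a b c d e f g h i a' b' c' d' e' f' g' h' i' : ℝ) : ∃ c0 c1 c2 : ℝ, ∀ t : ℝ,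
    d3 (a + t * a') (b + t * b') (c + t * c') (d + t * d') (e + t * e') (f + t * f')
      (g + t * g') (h + t * h') (i + t * i') =
    c0 + c1 * t + c2 * t ^ 2 + d3 a' b' c' d' e' f' g' h' i' * t ^ 3 := by
  refine ⟨d3 a b c d e f g h i, d3 a' b' c' d e f g h i + d3 a b c d' e' f' g h i +
    d3 a b c d e f g' h' i', d3 a b c d' e' f' g' h' i' + d3 a' b' c' d e f g' h' i' +
    d3 a' b' c' d' e' f' g h i, fun t => ?_⟩
  unfold d3
  ring

theorem perturb {ι : Type} [Fintype ι] {x y z : ι → ℝ}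
    (hN : 3 ≤ Fintype.card ι) (col : ι → Bool) (E : Finset (ι × ι))
    (hE : ∀ e ∈ E, col e.1 ≠ col e.2 ∧ Expo x y z e.1 e.2 ∧
      (x e.1 ≠ x e.2 ∨ y e.1 ≠ y e.2 ∨ z e.1 ≠ z e.2)) :
    E.card ≤ 4 * (Fintype.card ι - 2) := by
  let s : ι → ℝ := fun i => ((Fintype.equivFin ι i : ℕ) : ℝ)
  have hs : Function.Injective s := by
    intro i j h
    simp only [s, Nat.cast_inj] at h
    exact (Fintype.equivFin ι).injective (Fin.ext h)
  let X : ℝ → ι → ℝ := fun t i => x i + t * s i ^ 3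
  let Y : ℝ → ι → ℝ := fun t i => y i + t * s i ^ 2
  let Z : ℝ → ι → ℝ := fun t i => z i + t * s i
  have ev1 : ∀ᶠ t in nhdsWithin (0 : ℝ) {0}ᶜ, ∀ i j : ι, i ≠ j → Z t i ≠ Z t j := by
    rw [Filter.eventually_all]; intro i
    rw [Filter.eventually_all]; intro j
    by_cases hij : i = j
    · simp [hij]
    have hsij : s i - s j ≠ 0 := sub_ne_zero.2 fun h => hij (hs h)
    have : ∀ᶠ t in nhdsWithin (0 : ℝ) {0}ᶜ, t ≠ -(z i - z j) / (s i - s j) :=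
      nhdsNE_le_cofinite 0 (by simp [Filter.eventually_cofinite])
    filter_upwards [this] with t ht _ h
    apply ht
    rw [eq_div_iff hsij]
    simp only [Z] at h
    linarith
  have ev2 : ∀ᶠ t in nhdsWithin (0 : ℝ) {0}ᶜ, ∀ a b c d : ι,
      a ≠ b → a ≠ c → a ≠ d → b ≠ c → b ≠ d → c ≠ d → dt (X t) (Y t) (Z t) a b c d ≠ 0 := by
    rw [Filter.eventually_all]; intro a
    rw [Filter.eventually_all]; intro b
    rw [Filter.eventually_all]; intro c
    rw [Filter.eventually_all]; intro d
    by_cases hd : a ≠ b ∧ a ≠ c ∧ a ≠ d ∧ b ≠ c ∧ b ≠ d ∧ c ≠ d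
    swap
    · exact Filter.Eventually.of_forall fun t h1 h2 h3 h4 h5 h6 =>
        absurd ⟨h1, h2, h3, h4, h5, h6⟩ hd
    obtain ⟨h1, h2, h3, h4, h5, h6⟩ := hd
    let c3 := dt (fun i => s i ^ 3) (fun i => s i ^ 2) s a b c d
    have hc3 : c3 ≠ 0 := by
      have : c3 = -((s b - s a) * (s c - s a) * (s d - s a) * (s c - s b) * (s d - s b) *
        (s d - s c)) := by
        simp only [c3, dt]; ring
      rw [this]
      simp only [ne_eq, neg_eq_zero, mul_eq_zero, sub_eq_zero, hs.eq_iff, not_or]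
      exact ⟨⟨⟨⟨⟨h1.symm, h2.symm⟩, h3.symm⟩, h4.symm⟩, h5.symm⟩, h6.symm⟩
    obtain ⟨k0, k1, k2, hk⟩ := d3_cubic (x b - x a) (y b - y a) (z b - z a) (x c - x a) (y c - y a)
      (z c - z a) (x d - x a) (y d - y a) (z d - z a)
      (s b ^ 3 - s a ^ 3) (s b ^ 2 - s a ^ 2) (s b - s a)
      (s c ^ 3 - s a ^ 3) (s c ^ 2 - s a ^ 2) (s c - s a)
      (s d ^ 3 - s a ^ 3) (s d ^ 2 - s a ^ 2) (s d - s a)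
    filter_upwards [cubic_ev k0 k1 k2 c3 hc3] with t ht _ _ _ _ _ _ h0
    apply ht
    have hX : ∀ i j, X t i - X t j = (x i - x j) + t * (s i ^ 3 - s j ^ 3) := fun i j => by
      simp only [X]; ring
    have hY : ∀ i j, Y t i - Y t j = (y i - y j) + t * (s i ^ 2 - s j ^ 2) := fun i j => by
      simp only [Y]; ring
    have hZ : ∀ i j, Z t i - Z t j = (z i - z j) + t * (s i - s j) := fun i j => by
      simp only [Z]; ring
    have hk' := hk t
    rw [← h0]
    simp only [d3, ← hX, ← hY, ← hZ] at hk'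
    simp only [c3, dt]
    exact hk'.symm
  have ev3 : ∀ᶠ t in nhdsWithin (0 : ℝ) {0}ᶜ, ∀ e ∈ E, Expo (X t) (Y t) (Z t) e.1 e.2 := by
    rw [Filter.eventually_all_finset]
    rintro ⟨a, b⟩ he
    obtain ⟨-, ⟨u, v, w, h1, h2⟩, hne⟩ := hE _ he
    simp only at h1 h2 hne ⊢
    apply Filter.Eventually.filter_mono nhdsWithin_le_nhds
    let Q : ℝ → ℝ := fun t => (X t b - X t a) ^ 2 + (Y t b - Y t a) ^ 2 + (Z t b - Z t a) ^ 2
    let R : ℝ → ℝ := fun t => u * (X t b - X t a) + v * (Y t b - Y t a) + w * (Z t b - Z t a)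
    let u' : ℝ → ℝ := fun t => u - R t / Q t * (X t b - X t a)
    let v' : ℝ → ℝ := fun t => v - R t / Q t * (Y t b - Y t a)
    let w' : ℝ → ℝ := fun t => w - R t / Q t * (Z t b - Z t a)
    have cX : ∀ i, Continuous fun t => X t i := fun i => by simp only [X]; fun_prop
    have cY : ∀ i, Continuous fun t => Y t i := fun i => by simp only [Y]; fun_prop
    have cZ : ∀ i, Continuous fun t => Z t i := fun i => by simp only [Z]; fun_prop
    have cQ : Continuous Q := by simp only [Q]; fun_prop
    have cR : Continuous R := by simp only [R]; fun_prop
    have hQ0 : Q 0 ≠ 0 := by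
      simp only [Q, X, Y, Z, zero_mul, add_zero]
      rcases hne with h | h | h
      · have := sq_pos_of_ne_zero (sub_ne_zero.2 h.symm); positivity
      · have := sq_pos_of_ne_zero (sub_ne_zero.2 h.symm); positivity
      · have := sq_pos_of_ne_zero (sub_ne_zero.2 h.symm); positivity
    have hR0 : R 0 = 0 := by simp only [R, X, Y, Z]; linarith
    have cRQ : ContinuousAt (fun t => R t / Q t) 0 := cR.continuousAt.div cQ.continuousAt hQ0
    have cu : ContinuousAt u' 0 :=
      continuousAt_const.sub (cRQ.mul ((cX b).sub (cX a)).continuousAt)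
    have cv : ContinuousAt v' 0 :=
      continuousAt_const.sub (cRQ.mul ((cY b).sub (cY a)).continuousAt)
    have cw : ContinuousAt w' 0 :=
      continuousAt_const.sub (cRQ.mul ((cZ b).sub (cZ a)).continuousAt)
    let F : ℝ → ι → ℝ := fun t i => u' t * X t i + v' t * Y t i + w' t * Z t i
    have cF : ∀ i, ContinuousAt (fun t => F t i) 0 := fun i =>
      ((cu.mul (cX i).continuousAt).add (cv.mul (cY i).continuousAt)).add
        (cw.mul (cZ i).continuousAt)
    have hF0 : ∀ i, F 0 i = u * x i + v * y i + w * z i := fun i => by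
      simp only [F, u', v', w', hR0]; simp [X, Y, Z]
    have evs : ∀ᶠ t in nhds (0 : ℝ), ∀ i, i ≠ a → i ≠ b → F t i < F t a := by
      rw [Filter.eventually_all]; intro i
      by_cases hi : i ≠ a ∧ i ≠ b
      swap
      · exact Filter.Eventually.of_forall fun t g1 g2 => absurd ⟨g1, g2⟩ hi
      have : F 0 i < F 0 a := by rw [hF0, hF0]; exact h2 i hi.1 hi.2
      filter_upwards [(cF i).eventually_lt (cF a) this] with t ht _ _ using ht
    filter_upwards [evs, cQ.continuousAt.eventually_ne hQ0] with t ht hQ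
    refine ⟨u' t, v' t, w' t, ?_, ht⟩
    have hRQ : R t / Q t * Q t = R t := div_mul_cancel₀ _ hQ
    have hQe : Q t = (X t b - X t a) ^ 2 + (Y t b - Y t a) ^ 2 + (Z t b - Z t a) ^ 2 := rfl
    have hRe : R t = u * (X t b - X t a) + v * (Y t b - Y t a) + w * (Z t b - Z t a) := rfl
    simp only [u', v', w']
    linear_combination hRe + (R t / Q t) * (-hQe) + hRQ
  obtain ⟨t, h1, h2, h3⟩ := (ev1.and (ev2.and ev3)).exists
  refine gen_bound (x := X t) (y := Y t) (z := Z t) ⟨fun i j h => ?_, h2⟩ hN col E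
    fun e he => ⟨(hE e he).1, h3 e he⟩
  by_contra hij
  exact h1 i j hij h

lemma sphere_ineq (V : Finset (Euc 3)) (hV : ∀ v ∈ V, ‖v‖ = 1) {p q : Euc 3}
    (h : IsStrictDNPair V p q) (v : Euc 3) (hv : v ∈ V) (h1 : v ≠ p) (h2 : v ≠ q) :
    ⟪p - q, v⟫ < 1 - ⟪p, q⟫ ∧ -⟪p - q, v⟫ < 1 - ⟪p, q⟫ := by
  have hp : ⟪p, p⟫ = 1 := by rw [real_inner_self_eq_norm_sq, hV p h.1.1]; norm_num
  have hq : ⟪q, q⟫ = 1 := by rw [real_inner_self_eq_norm_sq, hV q h.1.2.1]; norm_num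
  have hpq : ⟪q, p⟫ = ⟪p, q⟫ := real_inner_comm _ _
  have hpv : ⟪v, p⟫ = ⟪p, v⟫ := real_inner_comm _ _
  have hqv : ⟪v, q⟫ = ⟪q, v⟫ := real_inner_comm _ _
  obtain ⟨a, b⟩ := h.2 v hv h1 h2
  simp only [inner_sub_left, inner_sub_right, hp, hq, hpq, hpv, hqv] at a b ⊢
  constructor <;> linarith

theorem strictDoubleNormal_sphere_upper_bound (V : Finset (Euc 3))
    (hV : ∀ v ∈ V, ‖v‖ = 1) (hcard : 4 ≤ V.card) :
    numStrictDN V ≤ 2 * V.card - 2 := by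
  unfold numStrictDN
  set S := (V ×ˢ V).filter fun pq => IsStrictDNPair V pq.1 pq.2 with hS
  let A := V.filter fun p => -p ∈ V
  let B := V.filter fun p => -p ∉ V
  have hAB : A.card + B.card = V.card := Finset.card_filter_add_card_filter_not _
  have hne1 : ∀ p q : Euc 3, IsStrictDNPair V p q → ⟪p, q⟫ < 1 := by
    intro p q h
    rw [← not_le]
    intro hle
    have hp := hV p h.1.1
    have hq := hV q h.1.2.1
    have : ⟪p, q⟫ = 1 := le_antisymm (by
      have := real_inner_le_norm p q
      rw [hp, hq] at this; linarith) hle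
    exact h.1.2.2.1 ((inner_eq_one_iff_of_norm_eq_one hp hq).1 this)
  have key : ∀ p q : Euc 3, IsStrictDNPair V p q → q ≠ -p → p ∈ B ∧ q ∈ B := by
    intro p q h hqp
    have hp : ⟪p, p⟫ = 1 := by rw [real_inner_self_eq_norm_sq, hV p h.1.1]; norm_num
    have hq : ⟪q, q⟫ = 1 := by rw [real_inner_self_eq_norm_sq, hV q h.1.2.1]; norm_num
    have hpq : ⟪q, p⟫ = ⟪p, q⟫ := real_inner_comm _ _
    constructor
    · refine Finset.mem_filter.2 ⟨h.1.1, fun hm => ?_⟩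
      have hn : -p ≠ p := fun e => by
        have : ⟪p, p⟫ = -⟪p, p⟫ := by rw [← inner_neg_left, e]
        linarith
      have := (sphere_ineq V hV h (-p) hm hn hqp.symm).2
      simp only [inner_neg_right, inner_sub_left, hp, hpq] at this
      linarith
    · refine Finset.mem_filter.2 ⟨h.1.2.1, fun hm => ?_⟩
      have hn : -q ≠ q := fun e => by
        have : ⟪q, q⟫ = -⟪q, q⟫ := by rw [← inner_neg_left, e]
        linarith
      have hn2 : -q ≠ p := fun e => hqp (by rw [← e, neg_neg])
      have := (sphere_ineq V hV h (-q) hm hn2 hn).1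
      simp only [inner_neg_right, inner_sub_left, hq, hpq] at this
      linarith
  have hsplit : (S.filter fun e => e.2 = -e.1).card + (S.filter fun e => ¬ e.2 = -e.1).card
      = S.card := Finset.card_filter_add_card_filter_not _
  have hanti : (S.filter fun e => e.2 = -e.1).card ≤ A.card := by
    refine Finset.card_le_card_of_injOn (fun e => e.1) ?_ ?_
    · rintro ⟨p, q⟩ he
      simp only [Finset.coe_filter, Set.mem_ofPred_eq, hS, Finset.mem_filter,
        Finset.mem_product] at he
      obtain ⟨⟨⟨h1, h2⟩, -⟩, rfl⟩ := he
      exact Finset.mem_filter.2 ⟨h1, h2⟩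
    · rintro ⟨p, q⟩ he ⟨p', q'⟩ he' hpp
      simp only [Finset.coe_filter, Set.mem_ofPred_eq] at he he' hpp
      rw [Prod.mk.injEq]
      exact ⟨hpp, by rw [he.2, he'.2, hpp]⟩
  set T := S.filter fun e => ¬ e.2 = -e.1 with hT
  have hTm : ∀ e ∈ T, IsStrictDNPair V e.1 e.2 ∧ e.1 ∈ B ∧ e.2 ∈ B ∧ e.2 ≠ -e.1 := by
    intro e he
    simp only [hT, hS, Finset.mem_filter] at he
    obtain ⟨k1, k2⟩ := key _ _ he.1.2 he.2
    exact ⟨he.1.2, k1, k2, he.2⟩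
  have hTcard : T.card ≤ 4 * (B.card - 1) := by
    by_cases hB : B.card ≤ 1
    · have : T = ∅ := by
        rw [Finset.eq_empty_iff_forall_notMem]
        intro e he
        obtain ⟨k1, k2, k3, -⟩ := hTm e he
        exact k1.1.2.2.1 (Finset.card_le_one.1 hB _ k2 _ k3)
      simp [this]
    have hB2 : 2 ≤ B.card := by omega
    have hcι : Fintype.card ({v // v ∈ B} × Bool) = 2 * B.card := by
      simp [mul_comm]
    let P : ({v // v ∈ B} × Bool) → Euc 3 := fun i => if i.2 then i.1.1 else -i.1.1
    let φ : {e // e ∈ T} × Bool → ({v // v ∈ B} × Bool) × ({v // v ∈ B} × Bool) := fun e =>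
      ((⟨e.1.1.1, (hTm _ e.1.2).2.1⟩, e.2), (⟨e.1.1.2, (hTm _ e.1.2).2.2.1⟩, !e.2))
    have hφ : Function.Injective φ := by
      rintro ⟨⟨⟨p, q⟩, h⟩, b⟩ ⟨⟨⟨p', q'⟩, h'⟩, b'⟩ hh
      simp only [φ, Prod.mk.injEq, Subtype.mk.injEq] at hh ⊢
      tauto
    have hE := perturb (x := fun i => P i 0) (y := fun i => P i 1) (z := fun i => P i 2)
      (by rw [hcι]; omega) (fun i : ({v // v ∈ B} × Bool) => i.2) (Finset.univ.image φ) ?_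
    · rw [Finset.card_image_of_injective _ hφ, hcι] at hE
      simp at hE
      omega
    intro e he
    obtain ⟨⟨⟨⟨p, q⟩, h⟩, b⟩, -, rfl⟩ := Finset.mem_image.1 he
    obtain ⟨k1, k2, k3, k4⟩ := hTm _ h
    simp only at k1 k2 k3 k4
    have hp : ⟪p, p⟫ = 1 := by rw [real_inner_self_eq_norm_sq, hV p k1.1.1]; norm_num
    have hq : ⟪q, q⟫ = 1 := by rw [real_inner_self_eq_norm_sq, hV q k1.1.2.1]; norm_num
    have hpq : ⟪q, p⟫ = ⟪p, q⟫ := real_inner_comm _ _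
    have hlt := hne1 p q k1
    have hpn := hV p k1.1.1
    have hqn := hV q k1.1.2.1
    have hin : ∀ v w : Euc 3, v 0 * w 0 + v 1 * w 1 + v 2 * w 2 = ⟪v, w⟫ := fun v w => by
      simp [PiLp.inner_apply, Fin.sum_univ_three, mul_comm]
    refine ⟨by simp [φ], ?_, ?_⟩
    · let D : Euc 3 := if b then p - q else q - p
      refine ⟨D 0, D 1, D 2, ?_, ?_⟩
      · simp only [hin]
        cases b <;> simp [D, P, φ, inner_sub_left, hp, hq, hpq, hpn, hqn]
      · rintro ⟨⟨v, hvB⟩, c⟩ n1 n2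
        simp only [hin]
        have hvV : v ∈ V := (Finset.mem_filter.1 hvB).1
        by_cases hvp : v = p
        · subst hvp
          cases b <;> cases c <;> simp [D, P, φ, inner_sub_left, hp, hq, hpq, hpn, hqn] at n1 n2 ⊢ <;> linarith
        by_cases hvq : v = q
        · subst hvq
          cases b <;> cases c <;> simp [D, P, φ, inner_sub_left, hp, hq, hpq, hpn, hqn] at n1 n2 ⊢ <;> linarith
        obtain ⟨g1, g2⟩ := sphere_ineq V hV k1 v hvV hvp hvq
        rw [inner_sub_left] at g1 g2
        cases b <;> cases c <;> simp [D, P, φ, inner_sub_left, hp, hq, hpq, hpn, hqn] <;> linarith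
    · by_contra hcon
      push Not at hcon
      obtain ⟨e0, e1, e2⟩ := hcon
      apply k4
      have : P (φ (⟨(p, q), h⟩, b)).1 = P (φ (⟨(p, q), h⟩, b)).2 := by
        ext i
        fin_cases i
        · exact e0
        · exact e1
        · exact e2
      cases b
      · simpa [P, φ] using this.symm
      · simp [P, φ] at this
        rw [this, neg_neg]
  omega
end
end
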